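/- Let δ > 0, let σ₂ be an invertible constant real d×d matrix, and let f : ℝ^d × 𝕋^d → ℝ^d and g : ℝ^d × 𝕋^d → ℝ be C¹ functions. Suppose u : ℝ^d × 𝕋^d → ℝ is such that for each x ∈ ℝ^d the map y ↦ u(x,y) is C², and u satisfies the elliptic equation δ u(x,y) − tr(σ₂σ₂ᵀ D²_{yy}u(x,y)) + f(x,y)·D_y u(x,y) = g(x,y) for all (x,y) ∈ ℝ^d × 𝕋^d. Then u is C¹: the derivatives D_x u(x,y) and D_y u(x,y) exist and are continuous on ℝ^d × 𝕋^d. -/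

import Mathlib

noncomputable section

open MeasureTheory Metric Filter
open scoped RealInnerProductSpace ENNReal Topology

instance : Fact ((0:ℝ) < 1) := ⟨one_pos⟩

/-- Euclidean space `ℝ^d`. -/
abbrev Euc (d : ℕ) := EuclideanSpace ℝ (Fin d)

/-- The flat torus `𝕋^d = ℝ^d/ℤ^d`, realized as a product of circles. -/
abbrev Torus (d : ℕ) := Fin d → AddCircle (1 : ℝ)

/-- Canonical projection `ℝ^d → 𝕋^d`. -/
def Torus.proj {d : ℕ} (y : Euc d) : Torus d := fun i => (y i : AddCircle (1 : ℝ))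

/-- The 1-Wasserstein distance between two (probability) measures on a metric
measurable space: the infimum over all couplings of the expected distance. -/
def W1 {X : Type*} [MeasurableSpace X] [PseudoMetricSpace X] (μ ν : Measure X) : ℝ :=
  ⨅ π : {π : Measure (X × X) //
      IsProbabilityMeasure π ∧ π.map Prod.fst = μ ∧ π.map Prod.snd = ν},
    ∫ z, dist z.1 z.2 ∂(π : Measure (X × X))

/-- `P(𝕋^d)`: Borel probability measures on the torus. -/
abbrev ProbT (d : ℕ) := ProbabilityMeasure (Torus d)

/-- 1-Wasserstein distance on `P(𝕋^d)`. -/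
def W1T {d : ℕ} (μ ν : ProbT d) : ℝ := W1 (μ : Measure (Torus d)) (ν : Measure (Torus d))

/-- Second partial derivative `∂²v/∂yᵢ∂yⱼ`. -/
def hess {d : ℕ} (v : Euc d → ℝ) (y : Euc d) (i j : Fin d) : ℝ :=
  iteratedFDeriv ℝ 2 v y ![EuclideanSpace.single i 1, EuclideanSpace.single j 1]

/-- `tr(a D²v)(y)` for a constant matrix `a`. -/
def trAH {d : ℕ} (a : Matrix (Fin d) (Fin d) ℝ) (v : Euc d → ℝ) (y : Euc d) : ℝ :=
  ∑ i, ∑ j, a i j * hess v y j i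

/-- The `ℤ^d`-periodic lift of a function on the torus. -/
def tlift {d : ℕ} (v : Torus d → ℝ) : Euc d → ℝ := fun y => v (Torus.proj y)

theorem second_deriv_nonpos_of_isLocalMax {ψ ψ' : ℝ → ℝ} {a c : ℝ}
    (h₁ : ∀ s, HasDerivAt ψ (ψ' s) s) (h₂ : HasDerivAt ψ' c a)
    (hmax : IsLocalMax ψ a) : c ≤ 0 := by
  by_contra! hc
  have hd : deriv ψ = ψ' := funext fun s => (h₁ s).deriv
  have hmin : IsLocalMin ψ a := isLocalMin_of_deriv_deriv_pos
    (by rw [hd, h₂.deriv]; exact hc) hmax.deriv_eq_zero (h₁ a).continuousAt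
  have hconst : ψ =ᶠ[𝓝 a] fun _ => ψ a := by
    filter_upwards [hmin, hmax] with s hs hs' using le_antisymm hs' hs
  have h0 : ψ' =ᶠ[𝓝 a] fun _ => 0 := by
    have := hconst.deriv
    rw [hd] at this
    simpa using this
  have := h₂.congr_of_eventuallyEq h0.symm |>.unique (hasDerivAt_const a 0)
  linarith

section Elliptic

variable {E : Type*} [NormedAddCommGroup E] [InnerProductSpace ℝ E]

theorem hasDerivAt_comp_line {w : E → ℝ} (hw : ContDiff ℝ 2 w) (y v : E) (s : ℝ) :
    HasDerivAt (fun s : ℝ => w (y + s • v)) (fderiv ℝ w (y + s • v) v) s := by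
  have h := (hw.differentiable (by norm_num) (y + s • v)).hasFDerivAt
  have hl : HasDerivAt (fun s : ℝ => y + s • v) v s := by
    simpa using ((hasDerivAt_id s).smul_const v).const_add y
  exact h.comp_hasDerivAt s hl

theorem hasDerivAt_fderiv_comp_line {w : E → ℝ} (hw : ContDiff ℝ 2 w) (y v : E) (s : ℝ) :
    HasDerivAt (fun s : ℝ => fderiv ℝ w (y + s • v) v)
      (fderiv ℝ (fderiv ℝ w) (y + s • v) v v) s := by
  have hw' : ContDiff ℝ 1 (fderiv ℝ w) := hw.fderiv_right (by norm_num)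
  have h := (hw'.differentiable (by norm_num) (y + s • v)).hasFDerivAt
  have hl : HasDerivAt (fun s : ℝ => y + s • v) v s := by
    simpa using ((hasDerivAt_id s).smul_const v).const_add y
  exact (ContinuousLinearMap.apply ℝ ℝ v).hasFDerivAt.comp_hasDerivAt s (h.comp_hasDerivAt s hl)

/-- The operator `δ w - ∑ₖ D²w (S bₖ, S bₖ) + Dw · c`. -/
def ellOp {ι : Type*} [Fintype ι] (δ : ℝ) (S : E ≃L[ℝ] E) (b : OrthonormalBasis ι ℝ E)
    (c : E → E) (w : E → ℝ) (y : E) : ℝ :=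
  δ * w y - ∑ k, fderiv ℝ (fderiv ℝ w) y (S (b k)) (S (b k)) + fderiv ℝ w y (c y)

variable {ι : Type*} [Fintype ι] {δ : ℝ} {S : E ≃L[ℝ] E} {b : OrthonormalBasis ι ℝ E}

theorem ellOp_sub {w₁ w₂ : E → ℝ} (h₁ : ContDiff ℝ 2 w₁) (h₂ : ContDiff ℝ 2 w₂)
    (c : E → E) (y : E) :
    ellOp δ S b c (w₁ - w₂) y = ellOp δ S b c w₁ y - ellOp δ S b c w₂ y := by
  have hd : fderiv ℝ (w₁ - w₂) = fderiv ℝ w₁ - fderiv ℝ w₂ := funext fun z =>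
    fderiv_sub (h₁.differentiable (by norm_num) z) (h₂.differentiable (by norm_num) z)
  have hd₁ : ContDiff ℝ 1 (fderiv ℝ w₁) := h₁.fderiv_right (by norm_num)
  have hd₂ : ContDiff ℝ 1 (fderiv ℝ w₂) := h₂.fderiv_right (by norm_num)
  simp only [ellOp]
  rw [hd, fderiv_sub (hd₁.differentiable (by norm_num) y) (hd₂.differentiable (by norm_num) y)]
  simp only [Pi.sub_apply, sub_apply, Finset.sum_sub_distrib]
  ring

theorem ellOp_neg {w : E → ℝ} (h : ContDiff ℝ 2 w) (c : E → E) (y : E) :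
    ellOp δ S b c (-w) y = - ellOp δ S b c w y := by
  have h0 : ContDiff ℝ 2 (0 : E → ℝ) := contDiff_const
  have := ellOp_sub (δ := δ) (S := S) (b := b) h0 h c y
  have h00 : ellOp δ S b c (0 : E → ℝ) y = 0 := by
    have : fderiv ℝ (0 : E → ℝ) = 0 := by ext; simp
    simp [ellOp, this]
  rw [h00, zero_sub, zero_sub] at this
  exact this

theorem ellOp_change_drift (c c' : E → E) (w : E → ℝ) (y : E) :
    ellOp δ S b c w y = ellOp δ S b c' w y + fderiv ℝ w y (c y - c' y) := by
  simp only [ellOp, map_sub]; ring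

theorem ellOp_le_of_isMax {w : E → ℝ} (hw : ContDiff ℝ 2 w) {c : E → E} {y : E}
    (hmax : ∀ z, w z ≤ w y) : δ * w y ≤ ellOp δ S b c w y := by
  have hD : fderiv ℝ w y = 0 :=
    IsLocalMax.fderiv_eq_zero (Filter.Eventually.of_forall hmax)
  have h2 : ∀ v, fderiv ℝ (fderiv ℝ w) y v v ≤ 0 := fun v => by
    have := second_deriv_nonpos_of_isLocalMax (hasDerivAt_comp_line hw y v)
      (hasDerivAt_fderiv_comp_line hw y v 0)
      (Filter.Eventually.of_forall fun s => by simpa using hmax (y + s • v))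
    simpa using this
  have := Finset.sum_nonpos fun k (_ : k ∈ Finset.univ) => h2 (S (b k))
  simp only [ellOp, hD, zero_apply]
  linarith

/-- The trace of a bilinear form is invariant under the reflection along a unit vector. -/
theorem sum_bilin_reflection (B : E →L[ℝ] E →L[ℝ] ℝ) (b : OrthonormalBasis ι ℝ E) {e : E}
    (he : ‖e‖ = 1) :
    ∑ k, B (b k - (2 * ⟪b k, e⟫) • e) (b k - (2 * ⟪b k, e⟫) • e) = ∑ k, B (b k) (b k) := by
  have hs := b.sum_repr' e
  have hn : ∑ k, ⟪b k, e⟫ * ⟪b k, e⟫ = 1 := by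
    have := b.sum_sq_norm_inner_right e
    simpa [he, Real.norm_eq_abs, sq_abs, sq] using this
  have h₁ : ∑ k, ⟪b k, e⟫ * B (b k) e = B e e := by
    simpa only [map_sum, map_smul, sum_apply, smul_apply, smul_eq_mul]
      using congrArg (fun t => B t e) hs
  have h₂ : ∑ k, ⟪b k, e⟫ * B e (b k) = B e e := by
    simpa only [map_sum, map_smul, smul_eq_mul] using congrArg (fun t => B e t) hs
  have : ∀ k, B (b k - (2 * ⟪b k, e⟫) • e) (b k - (2 * ⟪b k, e⟫) • e)
      = B (b k) (b k) - 2 * (⟪b k, e⟫ * B (b k) e) - 2 * (⟪b k, e⟫ * B e (b k))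
        + 4 * B e e * (⟪b k, e⟫ * ⟪b k, e⟫) := fun k => by
    simp only [map_sub, map_smul, sub_apply, smul_apply,
      smul_eq_mul]
    ring
  simp only [this, Finset.sum_add_distrib, Finset.sum_sub_distrib, ← Finset.mul_sum, h₁, h₂, hn]
  ring

/-- First- and second-order conditions at a maximum of `w y - w z - φ ‖S⁻¹ (y - z)‖`. -/
theorem doubling_conditions {w : E → ℝ} (hw : ContDiff ℝ 2 w) {φ φ' : ℝ → ℝ} {φ'' : ℝ} {r : ℝ}
    (hφ : ∀ s, HasDerivAt φ (φ' s) s) (hφ' : HasDerivAt φ' φ'' r) (hmono : Monotone φ)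
    {y z : E} (hr : ‖S.symm (y - z)‖ = r) (hr0 : 0 < r)
    (hmax : ∀ y' z', w y' - w z' - φ ‖S.symm (y' - z')‖ ≤ w y - w z - φ r) :
    fderiv ℝ w y = fderiv ℝ w z ∧ (∀ q, fderiv ℝ w y q ≤ φ' r * ‖S.symm q‖) ∧
      ∑ k, fderiv ℝ (fderiv ℝ w) y (S (b k)) (S (b k))
        - ∑ k, fderiv ℝ (fderiv ℝ w) z (S (b k)) (S (b k)) ≤ 4 * φ'' := by
  refine ⟨?_, ?_, ?_⟩
  · ext q
    have hd : HasDerivAt (fun s : ℝ => w (y + s • q) - w (z + s • q))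
        (fderiv ℝ w (y + (0 : ℝ) • q) q - fderiv ℝ w (z + (0 : ℝ) • q) q) 0 :=
      (hasDerivAt_comp_line hw y q 0).sub (hasDerivAt_comp_line hw z q 0)
    have hm : IsLocalMax (fun s : ℝ => w (y + s • q) - w (z + s • q)) 0 :=
      Filter.Eventually.of_forall fun s => by
        have := hmax (y + s • q) (z + s • q)
        rw [add_sub_add_right_eq_sub, hr] at this
        simpa using this
    have := hm.hasDerivAt_eq_zero hd
    simp only [zero_smul, add_zero] at this
    linarith
  · intro q
    have hd : HasDerivAt (fun s : ℝ => w (y + s • q) - φ (r + s * ‖S.symm q‖))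
        (fderiv ℝ w (y + (0 : ℝ) • q) q - φ' (r + 0 * ‖S.symm q‖) * ‖S.symm q‖) 0 := by
      refine (hasDerivAt_comp_line hw y q 0).sub ((hφ _).comp (0 : ℝ) ?_)
      simpa using ((hasDerivAt_id (0 : ℝ)).mul_const ‖S.symm q‖).const_add r
    have hm : ∀ s ∈ Set.Ici (0 : ℝ), w (y + s • q) - φ (r + s * ‖S.symm q‖)
        ≤ w (y + (0 : ℝ) • q) - φ (r + 0 * ‖S.symm q‖) := fun s hs => by
      have h1 := hmax (y + s • q) z
      have h2 : ‖S.symm (y + s • q - z)‖ ≤ r + s * ‖S.symm q‖ := by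
        rw [add_sub_right_comm, map_add, map_smul, ← hr]
        refine (norm_add_le _ _).trans ?_
        rw [norm_smul, Real.norm_of_nonneg hs]
      have := hmono h2
      simp only [zero_smul, add_zero, zero_mul]
      linarith
    have hloc : IsLocalMaxOn (fun s : ℝ => w (y + s • q) - φ (r + s * ‖S.symm q‖))
        (Set.Ici 0) 0 := IsMaxOn.localize hm
    have := hloc.hasFDerivWithinAt_nonpos hd.hasFDerivAt.hasFDerivWithinAt
      (y := 1) (mem_posTangentConeAt_of_segment_subset (by
        intro t ht; rw [segment_eq_Icc (by norm_num)] at ht; exact ht.1))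
    simp at this
    linarith
  · obtain ⟨e, hre, he⟩ : ∃ e : E, S.symm (y - z) = r • e ∧ ‖e‖ = 1 := by
      refine ⟨r⁻¹ • S.symm (y - z), by rw [smul_inv_smul₀ hr0.ne'], ?_⟩
      rw [norm_smul, hr, norm_inv, Real.norm_of_nonneg hr0.le, inv_mul_cancel₀ hr0.ne']
    have key : ∀ q, fderiv ℝ (fderiv ℝ w) y (S q) (S q)
        - fderiv ℝ (fderiv ℝ w) z (S (q - (2 * ⟪q, e⟫) • e)) (S (q - (2 * ⟪q, e⟫) • e))
        ≤ 4 * φ'' * (⟪q, e⟫ * ⟪q, e⟫) := by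
      intro q
      set a : ℝ := 2 * ⟪q, e⟫ with ha
      have hl : ∀ s : ℝ, HasDerivAt (fun s : ℝ => r + s * a) a s := fun s => by
        simpa using ((hasDerivAt_id s).mul_const a).const_add r
      have h₁ : ∀ s : ℝ, HasDerivAt
          (fun s : ℝ => w (y + s • S q) - w (z + s • S (q - a • e)) - φ (r + s * a))
          (fderiv ℝ w (y + s • S q) (S q) - fderiv ℝ w (z + s • S (q - a • e)) (S (q - a • e))
            - φ' (r + s * a) * a) s := fun s =>
        ((hasDerivAt_comp_line hw y _ s).sub (hasDerivAt_comp_line hw z _ s)).sub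
          ((hφ _).comp s (hl s))
      have h₂ : HasDerivAt (fun s : ℝ => fderiv ℝ w (y + s • S q) (S q)
            - fderiv ℝ w (z + s • S (q - a • e)) (S (q - a • e)) - φ' (r + s * a) * a)
          (fderiv ℝ (fderiv ℝ w) (y + (0 : ℝ) • S q) (S q) (S q)
            - fderiv ℝ (fderiv ℝ w) (z + (0 : ℝ) • S (q - a • e)) (S (q - a • e)) (S (q - a • e))
            - φ'' * a * a) 0 :=
        ((hasDerivAt_fderiv_comp_line hw y _ 0).sub (hasDerivAt_fderiv_comp_line hw z _ 0)).sub
          ((HasDerivAt.comp (0 : ℝ) (by simpa using hφ') (hl 0)).mul_const a)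
      have hpos : ∀ᶠ s : ℝ in 𝓝 0, 0 < r + s * a :=
        (hl 0).continuousAt.eventually (lt_mem_nhds (by simpa using hr0))
      have hm : IsLocalMax
          (fun s : ℝ => w (y + s • S q) - w (z + s • S (q - a • e)) - φ (r + s * a)) 0 := by
        filter_upwards [hpos] with s hs
        have := hmax (y + s • S q) (z + s • S (q - a • e))
        have hN : ‖S.symm (y + s • S q - (z + s • S (q - a • e)))‖ = r + s * a := by
          have : S.symm (y + s • S q - (z + s • S (q - a • e))) = (r + s * a) • e := by
            rw [add_sub_add_comm, map_add, hre, ← smul_sub, ← map_sub, map_smul,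
              S.symm_apply_apply, sub_sub_cancel, smul_smul, add_smul]
          rw [this, norm_smul, he, mul_one, Real.norm_of_nonneg hs.le]
        rw [hN] at this
        simpa using this
      have := second_deriv_nonpos_of_isLocalMax h₁ h₂ hm
      simp only [zero_smul, add_zero] at this
      have h4 : φ'' * a * a = 4 * φ'' * (⟪q, e⟫ * ⟪q, e⟫) := by rw [ha]; ring
      linarith
    have hsum := Finset.sum_le_sum fun k (_ : k ∈ Finset.univ) => key (b k)
    have hn : ∑ k, ⟪b k, e⟫ * ⟪b k, e⟫ = 1 := by
      have := b.sum_sq_norm_inner_right e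
      simpa [he, Real.norm_eq_abs, sq_abs, sq] using this
    have hrefl := sum_bilin_reflection
      ((fderiv ℝ (fderiv ℝ w) z).bilinearComp (S : E →L[ℝ] E) (S : E →L[ℝ] E)) b he
    simp only [ContinuousLinearMap.bilinearComp_apply, ContinuousLinearEquiv.coe_coe] at hrefl
    rw [← Finset.mul_sum, hn, Finset.sum_sub_distrib, hrefl] at hsum
    linarith

end Elliptic

section PeriodicElliptic

variable {E : Type*} [NormedAddCommGroup E] [InnerProductSpace ℝ E] [FiniteDimensional ℝ E]
  {ι : Type*} [Fintype ι] {δ : ℝ} {S : E ≃L[ℝ] E} {b : OrthonormalBasis ι ℝ E} {P : Set E}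

theorem exists_forall_le_of_periodic (hP : ∃ R, ∀ y : E, ∃ k ∈ P, ‖y + k‖ ≤ R) {w : E → ℝ}
    (hw : Continuous w) (hper : ∀ k ∈ P, ∀ y, w (y + k) = w y) : ∃ y, ∀ z, w z ≤ w y := by
  obtain ⟨R, hR⟩ := hP
  obtain ⟨k₀, -, hk₀⟩ := hR 0
  obtain ⟨y, -, hy⟩ := (isCompact_closedBall (0 : E) R).exists_isMaxOn
    ⟨0, by simpa using (norm_nonneg _).trans hk₀⟩ hw.continuousOn
  refine ⟨y, fun z => ?_⟩
  obtain ⟨k, hk, hzk⟩ := hR z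
  rw [← hper k hk z]
  exact hy (by simpa using hzk)

theorem le_of_ellOp_le (hP : ∃ R, ∀ y : E, ∃ k ∈ P, ‖y + k‖ ≤ R) (hδ : 0 < δ) {w : E → ℝ}
    (hw : ContDiff ℝ 2 w) (hper : ∀ k ∈ P, ∀ y, w (y + k) = w y) {c : E → E} {H : ℝ}
    (hH : ∀ y, ellOp δ S b c w y ≤ H) (y : E) : w y ≤ H / δ := by
  obtain ⟨y₀, hy₀⟩ := exists_forall_le_of_periodic hP hw.continuous hper
  have := (ellOp_le_of_isMax (S := S) (b := b) (c := c) (δ := δ) hw hy₀).trans (hH y₀)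
  rw [le_div_iff₀ hδ]
  nlinarith [hy₀ y]

theorem abs_le_of_abs_ellOp_le (hP : ∃ R, ∀ y : E, ∃ k ∈ P, ‖y + k‖ ≤ R) (hδ : 0 < δ) {w : E → ℝ}
    (hw : ContDiff ℝ 2 w) (hper : ∀ k ∈ P, ∀ y, w (y + k) = w y) {c : E → E} {H : ℝ}
    (hH : ∀ y, |ellOp δ S b c w y| ≤ H) (y : E) : |w y| ≤ H / δ := by
  refine abs_le.2 ⟨?_, le_of_ellOp_le hP hδ hw hper (fun y => (abs_le.1 (hH y)).2) y⟩
  have := le_of_ellOp_le (w := -w) (S := S) (b := b) (c := c) (H := H) hP hδ hw.neg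
    (fun k hk y => by simp [hper k hk y])
    (fun y => by rw [ellOp_neg hw]; linarith [(abs_le.1 (hH y)).1]) y
  simp only [Pi.neg_apply] at this
  linarith

/-- A maximum of `w y - w (y - S ξ) - φ ‖ξ‖` is attained if it is positive somewhere. -/
theorem exists_max_doubling (hP : ∃ R, ∀ y : E, ∃ k ∈ P, ‖y + k‖ ≤ R) (S : E ≃L[ℝ] E) {w : E → ℝ}
    (hw : Continuous w) (hper : ∀ k ∈ P, ∀ y, w (y + k) = w y) {φ : ℝ → ℝ} (hφ : Continuous φ)
    (hφ0 : φ 0 = 0) (hfar : ∀ y z r, 1 ≤ r → w y - w z ≤ φ r)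
    {y₀ z₀ : E} (hpos : 0 < w y₀ - w z₀ - φ ‖S.symm (y₀ - z₀)‖) :
    ∃ y z, 0 < ‖S.symm (y - z)‖ ∧ ‖S.symm (y - z)‖ ≤ 1 ∧
      0 < w y - w z - φ ‖S.symm (y - z)‖ ∧
      ∀ y' z', w y' - w z' - φ ‖S.symm (y' - z')‖ ≤ w y - w z - φ ‖S.symm (y - z)‖ := by
  obtain ⟨R, hR⟩ := hP
  obtain ⟨k₀, -, hk₀⟩ := hR 0
  set Ψ : E × E → ℝ := fun p => w p.1 - w (p.1 - S p.2) - φ ‖p.2‖ with hΨ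
  have hΨc : Continuous Ψ := by fun_prop
  have hR0 : 0 ≤ R := (norm_nonneg _).trans hk₀
  obtain ⟨⟨y, ξ⟩, hmem, hmax⟩ :=
    ((isCompact_closedBall (0 : E) R).prod (isCompact_closedBall (0 : E) 1)).exists_isMaxOn
      ⟨(0, 0), by simpa using hR0⟩ hΨc.continuousOn
  have hrepr : ∀ y z, w y - w z - φ ‖S.symm (y - z)‖ = Ψ (y, S.symm (y - z)) := fun y z => by
    simp [hΨ]
  have hle : ∀ y' ξ', ‖ξ'‖ ≤ 1 → Ψ (y', ξ') ≤ Ψ (y, ξ) := fun y' ξ' hξ' => by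
    obtain ⟨k, hk, hyk⟩ := hR y'
    have h1 : Ψ (y', ξ') = Ψ (y' + k, ξ') := by
      simp only [hΨ]
      rw [hper k hk, add_sub_right_comm, hper k hk]
    rw [h1]
    exact hmax (show (y' + k, ξ') ∈ _ by simpa using ⟨hyk, hξ'⟩)
  have hneg : ∀ y' ξ', 1 ≤ ‖ξ'‖ → Ψ (y', ξ') ≤ 0 := fun y' ξ' h => by
    have := hfar y' (y' - S ξ') ‖ξ'‖ h
    simp only [hΨ]; linarith
  rw [hrepr] at hpos
  have hmaxpos : 0 < Ψ (y, ξ) := by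
    rcases le_total ‖S.symm (y₀ - z₀)‖ 1 with h | h
    · exact hpos.trans_le (hle _ _ h)
    · exact absurd (hneg y₀ _ h) hpos.not_ge
  have hS : S.symm (y - (y - S ξ)) = ξ := by simp
  refine ⟨y, y - S ξ, ?_, ?_, ?_, fun y' z' => ?_⟩
  · rw [hS, norm_pos_iff]
    rintro rfl
    simp [hΨ, hφ0] at hmaxpos
  · rw [hS]; simpa using hmem.2
  · rw [hrepr, hS]; exact hmaxpos
  · rw [hrepr, hrepr, hS]
    rcases le_total ‖S.symm (y' - z')‖ 1 with h | h
    · exact hle _ _ h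
    · exact (hneg _ _ h).trans hmaxpos.le

/-- Lipschitz estimate of Ishii–Lions type. -/
theorem exists_lipschitz_estimate (hP : ∃ R, ∀ y : E, ∃ k ∈ P, ‖y + k‖ ≤ R) (hδ : 0 < δ)
    (S : E ≃L[ℝ] E) (b : OrthonormalBasis ι ℝ E) {B : ℝ} (hB : 0 ≤ B) :
    ∃ C, 0 ≤ C ∧ ∀ (w : E → ℝ) (c : E → E) (H : ℝ), ContDiff ℝ 2 w →
      (∀ k ∈ P, ∀ y, w (y + k) = w y) → (∀ y, ‖c y‖ ≤ B) → (∀ y, |ellOp δ S b c w y| ≤ H) →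
      ∀ y z, w y - w z ≤ C * H * ‖y - z‖ := by
  set τ : ℝ := ‖(S.symm : E →L[ℝ] E)‖ with hτ
  have hτ0 : 0 ≤ τ := norm_nonneg _
  have hτle : ∀ q, ‖S.symm q‖ ≤ τ * ‖q‖ := fun q => (S.symm : E →L[ℝ] E).le_opNorm q
  set μ : ℝ := τ * B + 1 with hμ
  have hμ1 : 1 ≤ μ := by rw [hμ]; nlinarith [mul_nonneg hτ0 hB]
  have hexp : 0 < 1 - Real.exp (-μ) := by
    have : Real.exp (-μ) < 1 := by rw [Real.exp_lt_one_iff]; linarith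
    linarith
  set κ : ℝ := Real.exp μ + 2 / (δ * (1 - Real.exp (-μ))) with hκ
  have hκ0 : 0 ≤ κ := by positivity
  refine ⟨κ * μ * τ, by positivity, fun w c H hw hper hc hH y₀ z₀ => ?_⟩
  have hH0 : 0 ≤ H := (abs_nonneg _).trans (hH 0)
  set K : ℝ := H * κ with hK
  have hK0 : 0 ≤ K := by positivity
  set φ : ℝ → ℝ := fun s => K * (1 - Real.exp (-(μ * s))) with hφ
  set φ' : ℝ → ℝ := fun s => K * μ * Real.exp (-(μ * s)) with hφ'
  have hinner : ∀ s : ℝ, HasDerivAt (fun s : ℝ => Real.exp (-(μ * s)))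
      (Real.exp (-(μ * s)) * -μ) s := fun s =>
    HasDerivAt.exp (((hasDerivAt_id s).const_mul μ).neg.congr_deriv (by simp))
  have hd : ∀ s, HasDerivAt φ (φ' s) s := fun s =>
    (((hinner s).const_sub 1).const_mul K).congr_deriv (by simp only [hφ']; ring)
  have hd' : ∀ s, HasDerivAt φ' (-(K * μ * μ * Real.exp (-(μ * s)))) s := fun s =>
    ((hinner s).const_mul (K * μ)).congr_deriv (by ring)
  have hmono : Monotone φ := monotone_of_deriv_nonneg (fun s => (hd s).differentiableAt)
    fun s => by rw [(hd s).deriv]; simp only [hφ']; positivity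
  have hφ0 : φ 0 = 0 := by simp [hφ]
  have hbound := abs_le_of_abs_ellOp_le hP hδ hw hper hH
  have hfar : ∀ y z r, 1 ≤ r → w y - w z ≤ φ r := fun y z r hr => by
    refine le_trans ?_ (hmono hr)
    have h1 := (abs_le.1 (hbound y)).2
    have h2 := (abs_le.1 (hbound z)).1
    have h3 : φ 1 = H * Real.exp μ * (1 - Real.exp (-μ)) + 2 * (H / δ) := by
      simp only [hφ, hK, hκ, mul_one]
      field_simp
    have : 0 ≤ H * Real.exp μ * (1 - Real.exp (-μ)) := by positivity
    linarith
  have hle : w y₀ - w z₀ ≤ φ ‖S.symm (y₀ - z₀)‖ := by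
    by_contra! hcon
    obtain ⟨y, z, hr0, hr1, hpos, hmax⟩ := exists_max_doubling hP S hw.continuous hper
      (continuous_iff_continuousAt.2 fun s => (hd s).continuousAt) hφ0 hfar
      (y₀ := y₀) (z₀ := z₀) (by linarith)
    set r := ‖S.symm (y - z)‖ with hr
    obtain ⟨hgrad, hdir, hsec⟩ := doubling_conditions (b := b) hw hd (hd' r) hmono hr.symm hr0 hmax
    have hy := (abs_le.1 (hH y)).2
    have hz := (abs_le.1 (hH z)).1
    simp only [ellOp] at hy hz
    have hdr : fderiv ℝ w z (c z) - fderiv ℝ w y (c y) ≤ φ' r * (τ * (2 * B)) := by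
      rw [← hgrad, ← map_sub]
      refine (hdir _).trans ?_
      have h0 : 0 ≤ φ' r := by simp only [hφ']; positivity
      have h1 : ‖c z - c y‖ ≤ 2 * B := (norm_sub_le _ _).trans (by linarith [hc z, hc y])
      gcongr
      exact (hτle _).trans (by gcongr)
    have hφr : 0 ≤ φ r := hφ0 ▸ hmono hr0.le
    have hw0 : 0 < δ * (w y - w z) := mul_pos hδ (by linarith)
    have hexpr : Real.exp (-μ) ≤ Real.exp (-(μ * r)) := by
      rw [Real.exp_le_exp]; nlinarith
    have hKe : H ≤ K * Real.exp (-(μ * r)) := by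
      have h1 : H = H * Real.exp μ * Real.exp (-μ) := by
        rw [mul_assoc, ← Real.exp_add]; simp
      have h2 : H * Real.exp μ ≤ K := by
        rw [hK]; gcongr; rw [hκ]; linarith [show 0 ≤ 2 / (δ * (1 - Real.exp (-μ))) by positivity]
      rw [h1]
      gcongr
    have hfin : 4 * -(K * μ * μ * Real.exp (-(μ * r))) + φ' r * (τ * (2 * B)) + 2 * H ≤ 0 := by
      have h1 : 4 * -(K * μ * μ * Real.exp (-(μ * r))) + φ' r * (τ * (2 * B))
          = -((K * Real.exp (-(μ * r))) * (μ * (2 * μ + 2))) := by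
        simp only [hφ']
        rw [show τ * (2 * B) = 2 * (μ - 1) by rw [hμ]; ring]
        ring
      rw [h1]
      nlinarith [mul_le_mul hKe (show (2 : ℝ) ≤ μ * (2 * μ + 2) by nlinarith) (by norm_num)
        (hH0.trans hKe)]
    linarith
  have hφle : ∀ s, φ s ≤ K * μ * s := fun s => by
    have := Real.add_one_le_exp (-(μ * s))
    simp only [hφ]
    nlinarith
  calc w y₀ - w z₀ ≤ K * μ * ‖S.symm (y₀ - z₀)‖ := hle.trans (hφle _)
    _ ≤ K * μ * (τ * ‖y₀ - z₀‖) := by gcongr; exact hτle _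
    _ = κ * μ * τ * H * ‖y₀ - z₀‖ := by rw [hK]; ring

/-- A priori bounds on a periodic function and its gradient in terms of `ellOp`. -/
theorem exists_apriori_estimate (hP : ∃ R, ∀ y : E, ∃ k ∈ P, ‖y + k‖ ≤ R) (hδ : 0 < δ)
    (S : E ≃L[ℝ] E) (b : OrthonormalBasis ι ℝ E) {B : ℝ} (hB : 0 ≤ B) :
    ∃ C, 0 ≤ C ∧ ∀ (w : E → ℝ) (c : E → E) (H : ℝ), ContDiff ℝ 2 w →
      (∀ k ∈ P, ∀ y, w (y + k) = w y) → (∀ y, ‖c y‖ ≤ B) → (∀ y, |ellOp δ S b c w y| ≤ H) →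
      ∀ y, |w y| ≤ C * H ∧ ‖fderiv ℝ w y‖ ≤ C * H := by
  obtain ⟨C, hC, hest⟩ := exists_lipschitz_estimate hP hδ S b hB
  refine ⟨C + 1 / δ, by positivity, fun w c H hw hper hc hH y => ?_⟩
  have hH0 : 0 ≤ H := (abs_nonneg _).trans (hH 0)
  have hHδ : 0 ≤ H / δ := by positivity
  have hCH : 0 ≤ C * H := by positivity
  have hsum : (C + 1 / δ) * H = C * H + H / δ := by ring
  rw [hsum]
  refine ⟨(abs_le_of_abs_ellOp_le hP hδ hw hper hH y).trans (by linarith), ?_⟩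
  refine (norm_fderiv_le_of_lip' ℝ hCH (Filter.Eventually.of_forall fun z => ?_)).trans
    (show C * H ≤ _ by linarith)
  rw [Real.norm_eq_abs, abs_le]
  have h1 := hest w c H hw hper hc hH z y
  have h2 := hest w c H hw hper hc hH y z
  rw [norm_sub_rev] at h2
  exact ⟨by linarith, h1⟩

end PeriodicElliptic

section StrictDiff

variable {X F : Type*} [NormedAddCommGroup X] [NormedAddCommGroup F]

theorem norm_increment_nsmul_sub_le {f : X → F} {x₀ : X} {ε η : ℝ}
    (h : ∀ x ∈ ball x₀ η, ∀ e, ‖e‖ < η → ‖f (x + e) - f x - (f (x₀ + e) - f x₀)‖ ≤ ε * ‖e‖)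
    {e : X} (n : ℕ) (hn : n * ‖e‖ < η) (he : ‖e‖ < η) :
    ‖f (x₀ + n • e) - f x₀ - n • (f (x₀ + e) - f x₀)‖ ≤ n * (ε * ‖e‖) := by
  induction n with
  | zero => simp
  | succ n ih =>
    push_cast at hn
    have hn' : n * ‖e‖ < η := lt_of_le_of_lt (by nlinarith [norm_nonneg e]) hn
    have h1 := h (x₀ + n • e) (by
      rw [mem_ball_iff_norm, add_sub_cancel_left]
      exact (norm_nsmul_le).trans_lt hn') e he
    have h2 := ih hn'
    have h3 : f (x₀ + (n + 1) • e) - f x₀ - (n + 1) • (f (x₀ + e) - f x₀)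
        = (f (x₀ + n • e + e) - f (x₀ + n • e) - (f (x₀ + e) - f x₀))
          + (f (x₀ + n • e) - f x₀ - n • (f (x₀ + e) - f x₀)) := by
      rw [succ_nsmul, succ_nsmul, add_assoc]; abel
    rw [h3]
    refine (norm_add_le _ _).trans ?_
    push_cast
    linarith

variable [NormedSpace ℝ X] [NormedSpace ℝ F]

/-- A continuous function whose increments `f (x + e) - f x` depend on `x` only up to `o(e)` near
`x₀` is strictly differentiable at `x₀`. -/
theorem exists_hasStrictFDerivAt_of_increments [CompleteSpace F] {f : X → F} {x₀ : X}
    (hc : ContinuousAt f x₀)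
    (h : ∀ ε > 0, ∀ᶠ p : X × X × X in 𝓝 (x₀, x₀, 0),
      ‖f (p.1 + p.2.2) - f p.1 - (f (p.2.1 + p.2.2) - f p.2.1)‖ ≤ ε * ‖p.2.2‖) :
    ∃ f' : X →L[ℝ] F, HasStrictFDerivAt f f' x₀ := by
  have hball : ∀ ε > 0, ∃ η > 0, ∀ x ∈ ball x₀ η, ∀ e, ‖e‖ < η →
      ‖f (x + e) - f x - (f (x₀ + e) - f x₀)‖ ≤ ε * ‖e‖ := fun ε hε => by
    obtain ⟨η, hη, hs⟩ := Metric.eventually_nhds_iff_ball.1 (h ε hε)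
    refine ⟨η, hη, fun x hx e he => hs (x, x₀, e) ?_⟩
    rw [← ball_prod_same, ← ball_prod_same]
    exact ⟨hx, mem_ball_self hη, by simpa using he⟩
  set q : X → F := fun e => f (x₀ + e) - f x₀ with hq
  set a : X → ℕ → F := fun e n => (n : ℝ) • q ((n : ℝ)⁻¹ • e) with ha
  have hmul : ∀ {ε η : ℝ}, 0 < ε →
      (∀ x ∈ ball x₀ η, ∀ e, ‖e‖ < η → ‖f (x + e) - f x - (f (x₀ + e) - f x₀)‖ ≤ ε * ‖e‖) →
      ∀ e, ∀ n m : ℕ, 0 < n → 0 < m → ‖e‖ < n * η → ‖a e n - a e (n * m)‖ ≤ ε * ‖e‖ := by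
    intro ε η hε hs e n m hn hm he
    have hn' : (0 : ℝ) < n := by exact_mod_cast hn
    have hm' : (1 : ℝ) ≤ m := by exact_mod_cast hm
    set t : X := ((n * m : ℕ) : ℝ)⁻¹ • e with ht
    have hmt : m • t = (n : ℝ)⁻¹ • e := by
      rw [ht, ← Nat.cast_smul_eq_nsmul ℝ, smul_smul]
      congr 1
      push_cast
      field_simp
    have hnt : m * ‖t‖ = (n : ℝ)⁻¹ * ‖e‖ := by
      rw [ht, norm_smul, norm_inv, Real.norm_of_nonneg (by positivity)]
      push_cast
      field_simp
    have h1 : m * ‖t‖ < η := by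
      rw [hnt, inv_mul_lt_iff₀ hn']; exact he
    have h2 := norm_increment_nsmul_sub_le hs m h1
      (lt_of_le_of_lt (by nlinarith [norm_nonneg t]) h1)
    have h3 : a e n - a e (n * m) = (n : ℝ) • (q (m • t) - m • q t) := by
      change (n : ℝ) • q ((n : ℝ)⁻¹ • e) - ((n * m : ℕ) : ℝ) • q t = _
      rw [hmt, ← Nat.cast_smul_eq_nsmul ℝ m, Nat.cast_mul, mul_smul,
        ← smul_sub (n : ℝ) (q _) ((m : ℝ) • q t)]
    rw [h3, norm_smul, Real.norm_of_nonneg hn'.le]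
    calc (n : ℝ) * ‖q (m • t) - m • q t‖ ≤ n * (m * (ε * ‖t‖)) := by gcongr
      _ = n * ε * (m * ‖t‖) := by ring
      _ = ε * ‖e‖ := by rw [hnt]; field_simp
  have hcauchy : ∀ e, CauchySeq (a e) := fun e => by
    rw [Metric.cauchySeq_iff']
    intro ε hε
    have hε' : 0 < ε / (4 * (‖e‖ + 1)) := by positivity
    obtain ⟨η, hη, hs⟩ := hball _ hε'
    obtain ⟨N, hN⟩ := exists_nat_gt (‖e‖ / η)
    have hsmall : ε / (4 * (‖e‖ + 1)) * ‖e‖ ≤ ε / 4 := by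
      rw [div_mul_eq_mul_div, div_le_div_iff₀ (by positivity) (by positivity)]
      nlinarith [norm_nonneg e]
    refine ⟨N + 1, fun n hn => ?_⟩
    have hbig : ∀ n : ℕ, N + 1 ≤ n → ‖e‖ < n * η := fun n hn => by
      rw [div_lt_iff₀ hη] at hN
      have : (N : ℝ) ≤ n := by exact_mod_cast (Nat.le_succ N).trans hn
      nlinarith
    have h1 := hmul hε' hs e n (N + 1) (by omega) (by omega) (hbig n hn)
    have h2 := hmul hε' hs e (N + 1) n (by omega) (by omega) (hbig _ le_rfl)
    rw [mul_comm (N + 1) n] at h2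
    rw [dist_eq_norm]
    have h3 : a e n - a e (N + 1) = (a e n - a e (n * (N + 1))) - (a e (N + 1) - a e (n * (N + 1))) := by
      abel
    rw [h3]
    refine (norm_sub_le _ _).trans_lt ?_
    linarith
  choose V hV using fun e => cauchySeq_tendsto_of_complete (hcauchy e)
  have hqV : ∀ ε > 0, ∃ η > 0, ∀ x ∈ ball x₀ η, ∀ e, ‖e‖ < η →
      ‖f (x + e) - f x - V e‖ ≤ 2 * ε * ‖e‖ := fun ε hε => by
    obtain ⟨η, hη, hs⟩ := hball ε hε
    refine ⟨η, hη, fun x hx e he => ?_⟩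
    have h1 : ‖q e - V e‖ ≤ ε * ‖e‖ := by
      refine le_of_tendsto ((tendsto_const_nhds.sub (hV e)).norm) ?_
      filter_upwards [eventually_gt_atTop 0] with n hn
      have := hmul hε hs e 1 n one_pos hn (by simpa using he)
      simpa [ha] using this
    have h2 := hs x hx e he
    have h3 : f (x + e) - f x - V e = (f (x + e) - f x - q e) + (q e - V e) := by abel
    rw [h3]
    refine (norm_add_le _ _).trans ?_
    linarith
  have hadd : ∀ e e', V (e + e') = V e + V e' := fun e e' => by
    have hinv : Tendsto (fun n : ℕ => (n : ℝ)⁻¹) atTop (𝓝 0) := tendsto_inv_atTop_nhds_zero_nat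
    have hlim := ((hV (e + e')).sub (hV e)).sub (hV e')
    have hzero : Tendsto (fun n => a (e + e') n - a e n - a e' n) atTop (𝓝 0) := by
      rw [Metric.tendsto_nhds]
      intro ε hε
      obtain ⟨η, hη, hs⟩ := hball (ε / (‖e'‖ + 1)) (by positivity)
      have hsm : ∀ v : X, ∀ᶠ n : ℕ in atTop, ‖(n : ℝ)⁻¹ • v‖ < η := fun v => by
        have : Tendsto (fun n : ℕ => ‖(n : ℝ)⁻¹ • v‖) atTop (𝓝 0) := by
          simpa using (hinv.smul_const v).norm
        exact this.eventually (gt_mem_nhds hη)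
      filter_upwards [hsm e, hsm e', eventually_gt_atTop 0] with n hn hn' hpos
      have hpos' : (0 : ℝ) < n := by exact_mod_cast hpos
      have h1 := hs (x₀ + (n : ℝ)⁻¹ • e) (by simpa [mem_ball_iff_norm] using hn) _ hn'
      have h2 : a (e + e') n - a e n - a e' n = (n : ℝ) • (f (x₀ + (n : ℝ)⁻¹ • e + (n : ℝ)⁻¹ • e')
          - f (x₀ + (n : ℝ)⁻¹ • e) - (f (x₀ + (n : ℝ)⁻¹ • e') - f x₀)) := by
        simp only [ha, hq, ← smul_sub, smul_add, add_assoc]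
        congr 1
        abel
      rw [dist_zero_right, h2, norm_smul, Real.norm_of_nonneg hpos'.le]
      calc _ ≤ (n : ℝ) * (ε / (‖e'‖ + 1) * ‖(n : ℝ)⁻¹ • e'‖) := by gcongr
        _ = ε * (‖e'‖ / (‖e'‖ + 1)) := by
          rw [norm_smul, norm_inv, Real.norm_of_nonneg hpos'.le]; field_simp
        _ < ε * 1 := by
          gcongr
          rw [div_lt_one (by positivity)]; linarith
        _ = ε := mul_one ε
    have := tendsto_nhds_unique hlim hzero
    rw [sub_sub, sub_eq_zero] at this
    exact this
  have hV0 : V 0 = 0 := by simpa using hadd 0 0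
  let VA : X →+ F := { toFun := V, map_zero' := hV0, map_add' := hadd }
  have hcont : Continuous VA := by
    refine continuous_of_continuousAt_zero VA ?_
    rw [ContinuousAt, map_zero]
    obtain ⟨η, hη, hs⟩ := hqV 1 one_pos
    have hq0 : Tendsto (fun e => f (x₀ + e) - f x₀) (𝓝 0) (𝓝 0) := by
      have : Tendsto (fun e => x₀ + e) (𝓝 0) (𝓝 x₀) := by
        simpa using ((continuous_const_add x₀).tendsto (0 : X))
      simpa using (hc.tendsto.comp this).sub_const (f x₀)
    have hbd : Tendsto (fun e => ‖f (x₀ + e) - f x₀‖ + 2 * 1 * ‖e‖) (𝓝 0) (𝓝 0) := by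
      have := hq0.norm.add ((continuous_norm.tendsto (0 : X)).const_mul (2 * 1))
      rwa [norm_zero, norm_zero, mul_zero, add_zero] at this
    refine squeeze_zero_norm' ?_ hbd
    filter_upwards [ball_mem_nhds (0 : X) hη] with e he
    have h1 := hs x₀ (mem_ball_self hη) e (by simpa using he)
    have h2 : VA e = (f (x₀ + e) - f x₀) - (f (x₀ + e) - f x₀ - V e) := by
      simp [VA]
    rw [h2]
    exact (norm_sub_le _ _).trans (by gcongr)
  refine ⟨VA.toRealLinearMap hcont, ?_⟩
  rw [hasStrictFDerivAt_iff_isLittleO, Asymptotics.isLittleO_iff]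
  intro ε hε
  obtain ⟨η, hη, hs⟩ := hqV (ε / 2) (by positivity)
  have h1 : Tendsto (fun p : X × X => p.2) (𝓝 (x₀, x₀)) (𝓝 x₀) := continuous_snd.tendsto _
  have h2 : Tendsto (fun p : X × X => ‖p.1 - p.2‖) (𝓝 (x₀, x₀)) (𝓝 0) := by
    simpa using (continuous_fst.sub continuous_snd).norm.tendsto ((x₀, x₀) : X × X)
  filter_upwards [h1.eventually (ball_mem_nhds x₀ hη), h2.eventually (gt_mem_nhds hη)]
    with p hp hp'
  have := hs p.2 hp _ hp'
  simpa [mul_div_cancel₀, VA] using this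

theorem contDiff_one_of_forall_exists_hasStrictFDerivAt {f : X → F}
    (h : ∀ x, ∃ f' : X →L[ℝ] F, HasStrictFDerivAt f f' x) : ContDiff ℝ 1 f := by
  choose f' hf' using h
  refine contDiff_one_iff_hasFDerivAt.2 ⟨f', ?_, fun x => (hf' x).hasFDerivAt⟩
  rw [continuous_iff_continuousAt]
  intro x
  rw [Metric.continuousAt_iff']
  intro ε hε
  have hlip := (hf' x).isLittleO.def (half_pos hε)
  obtain ⟨η, hη, hs⟩ := Metric.eventually_nhds_iff_ball.1 hlip
  filter_upwards [ball_mem_nhds x hη] with z hz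
  rw [dist_eq_norm]
  refine lt_of_le_of_lt ?_ (half_lt_self hε)
  refine ((hf' z).hasFDerivAt.sub (f' x).hasFDerivAt).le_of_lip' (half_pos hε).le ?_
  filter_upwards [isOpen_ball.mem_nhds hz] with y hy
  have := hs (y, z) (by rw [← ball_prod_same]; exact ⟨hy, hz⟩)
  simp only [map_sub] at this
  have h1 : (f - (f' x : X → F)) y - (f - (f' x : X → F)) z = f y - f z - (f' x y - f' x z) := by
    simp only [Pi.sub_apply]
    abel
  rwa [h1]

end StrictDiff

section UniformBounds

variable {X E Z : Type*} [NormedAddCommGroup X] [NormedAddCommGroup E] [ProperSpace E]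
  [NormedAddCommGroup Z] {P : Set E} {Φ : X × E → Z}

theorem eventually_forall_of_periodic {T : Type*} [TopologicalSpace T] {t₀ : T}
    (hP : ∃ R, ∀ y : E, ∃ k ∈ P, ‖y + k‖ ≤ R) {Q : T → E → Prop}
    (hQ : ∀ k ∈ P, ∀ t y, Q t (y + k) → Q t y)
    (h : ∀ y, ∀ᶠ p : T × E in 𝓝 (t₀, y), Q p.1 p.2) : ∀ᶠ t in 𝓝 t₀, ∀ y, Q t y := by
  obtain ⟨R, hR⟩ := hP
  filter_upwards [(isCompact_closedBall (0 : E) R).eventually_forall_of_forall_eventually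
    fun y _ => h y] with t ht y
  obtain ⟨k, hk, hyk⟩ := hR y
  exact hQ k hk t y (ht _ (by simpa using hyk))

theorem exists_bound_of_periodic (hP : ∃ R, ∀ y : E, ∃ k ∈ P, ‖y + k‖ ≤ R) {w : E → Z}
    (hw : Continuous w) (hper : ∀ k ∈ P, ∀ y, w (y + k) = w y) : ∃ C, ∀ y, ‖w y‖ ≤ C := by
  obtain ⟨R, hR⟩ := hP
  obtain ⟨C, hC⟩ := (isCompact_closedBall (0 : E) R).exists_bound_of_continuousOn hw.continuousOn
  refine ⟨C, fun y => ?_⟩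
  obtain ⟨k, hk, hyk⟩ := hR y
  rw [← hper k hk y]
  exact hC _ (by simpa using hyk)

theorem exists_eventually_norm_le (hP : ∃ R, ∀ y : E, ∃ k ∈ P, ‖y + k‖ ≤ R)
    (hΦ : Continuous Φ) (hper : ∀ k ∈ P, ∀ x y, Φ (x, y + k) = Φ (x, y)) (x₀ : X) :
    ∃ B, 0 ≤ B ∧ ∀ᶠ x in 𝓝 x₀, ∀ y, ‖Φ (x, y)‖ ≤ B := by
  obtain ⟨C, hC⟩ := exists_bound_of_periodic hP (w := fun y => Φ (x₀, y)) (by fun_prop)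
    fun k hk y => hper k hk x₀ y
  refine ⟨C + 1, by linarith [(norm_nonneg _).trans (hC 0)],
    eventually_forall_of_periodic hP (fun k hk t y h => by rwa [← hper k hk]) fun y => ?_⟩
  have : ‖Φ (x₀, y)‖ < C + 1 := by linarith [hC y]
  filter_upwards [hΦ.norm.continuousAt.eventually (gt_mem_nhds this)] with p hp using hp.le

variable [NormedSpace ℝ X] [NormedSpace ℝ E] [NormedSpace ℝ Z]

/-- Strict differentiability in the parameter, uniformly in the periodic variable. -/
theorem eventually_norm_increment_sub_le (hP : ∃ R, ∀ y : E, ∃ k ∈ P, ‖y + k‖ ≤ R)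
    (hΦ : ContDiff ℝ 1 Φ) (hper : ∀ k ∈ P, ∀ x y, Φ (x, y + k) = Φ (x, y)) (x₀ : X)
    {ε : ℝ} (hε : 0 < ε) :
    ∀ᶠ p : X × X × X in 𝓝 (x₀, x₀, 0), ∀ y,
      ‖Φ (p.1 + p.2.2, y) - Φ (p.1, y) - (Φ (p.2.1 + p.2.2, y) - Φ (p.2.1, y))‖
        ≤ ε * ‖p.2.2‖ := by
  refine eventually_forall_of_periodic hP (fun k hk t y h => by simpa only [hper k hk] using h)
    fun y => ?_
  have hs := (hΦ.hasStrictFDerivAt (x := (x₀, y)) (by norm_num)).isLittleO.def (half_pos hε)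
  have h1 : Tendsto (fun q : (X × X × X) × E => ((q.1.1 + q.1.2.2, q.2), (q.1.1, q.2)))
      (𝓝 ((x₀, x₀, 0), y)) (𝓝 ((x₀, y), (x₀, y))) :=
    Continuous.tendsto' (by fun_prop) _ _ (by simp)
  have h2 : Tendsto (fun q : (X × X × X) × E => ((q.1.2.1 + q.1.2.2, q.2), (q.1.2.1, q.2)))
      (𝓝 ((x₀, x₀, 0), y)) (𝓝 ((x₀, y), (x₀, y))) :=
    Continuous.tendsto' (by fun_prop) _ _ (by simp)
  filter_upwards [h1.eventually hs, h2.eventually hs] with q hq1 hq2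
  simp only [Prod.mk_sub_mk, add_sub_cancel_left, sub_self, Prod.norm_mk, norm_zero,
    max_eq_left (norm_nonneg _)] at hq1 hq2
  have h3 := norm_sub_le_of_le hq1 hq2
  rw [sub_sub_sub_cancel_right] at h3
  exact h3.trans_eq (by ring)

theorem exists_eventually_norm_sub_le (hP : ∃ R, ∀ y : E, ∃ k ∈ P, ‖y + k‖ ≤ R)
    (hΦ : ContDiff ℝ 1 Φ) (hper : ∀ k ∈ P, ∀ x y, Φ (x, y + k) = Φ (x, y)) (x₀ : X) :
    ∃ Λ, 0 ≤ Λ ∧ ∀ᶠ p : X × X in 𝓝 (x₀, x₀), ∀ y,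
      ‖Φ (p.1, y) - Φ (p.2, y)‖ ≤ Λ * ‖p.1 - p.2‖ := by
  have hder : Continuous (fderiv ℝ Φ) := hΦ.continuous_fderiv (by norm_num)
  have hdper : ∀ k ∈ P, ∀ y, fderiv ℝ Φ (x₀, y + k) = fderiv ℝ Φ (x₀, y) := fun k hk y => by
    have h1 : (fun z : X × E => Φ (z + (0, k))) = Φ := by
      ext ⟨x, y⟩
      simpa using hper k hk x y
    have h2 := fderiv_comp_add_right (𝕜 := ℝ) (f := Φ) (x := (x₀, y)) (0, k)
    rw [h1] at h2
    simpa using h2.symm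
  obtain ⟨C, hC⟩ := exists_bound_of_periodic hP (w := fun y => fderiv ℝ Φ (x₀, y)) (by fun_prop)
    hdper
  have hC0 : 0 ≤ C := (norm_nonneg _).trans (hC 0)
  refine ⟨C + 1, by linarith,
    eventually_forall_of_periodic hP (fun k hk t y h => by simpa only [hper k hk] using h)
      fun y => ?_⟩
  have hs := (hΦ.hasStrictFDerivAt (x := (x₀, y)) (by norm_num)).isLittleO.def one_pos
  have h1 : Tendsto (fun q : (X × X) × E => ((q.1.1, q.2), (q.1.2, q.2)))
      (𝓝 ((x₀, x₀), y)) (𝓝 ((x₀, y), (x₀, y))) :=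
    Continuous.tendsto' (by fun_prop) _ _ (by simp)
  filter_upwards [h1.eventually hs] with q hq
  have hop := (fderiv ℝ Φ (x₀, y)).le_of_opNorm_le (hC y) ((q.1.1, q.2) - (q.1.2, q.2))
  simp only [Prod.mk_sub_mk, sub_self, Prod.norm_mk, norm_zero,
    max_eq_left (norm_nonneg _)] at hq hop
  have := norm_add_le_of_le hq hop
  rw [sub_add_cancel] at this
  exact this.trans_eq (by ring)

end UniformBounds

section Parametric

variable {X E : Type*} [NormedAddCommGroup X] [NormedSpace ℝ X]
  [NormedAddCommGroup E] [InnerProductSpace ℝ E] [FiniteDimensional ℝ E]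
  {ι : Type*} [Fintype ι] {δ : ℝ} {S : E ≃L[ℝ] E} {b : OrthonormalBasis ι ℝ E} {P : Set E}
  {F : X × E → E} {G : X × E → ℝ} {U : X → E → ℝ}

theorem exists_eventually_solution_bounds (hP : ∃ R, ∀ y : E, ∃ k ∈ P, ‖y + k‖ ≤ R) (hδ : 0 < δ)
    (hF : ContDiff ℝ 1 F) (hFper : ∀ k ∈ P, ∀ x y, F (x, y + k) = F (x, y))
    (hG : ContDiff ℝ 1 G) (hGper : ∀ k ∈ P, ∀ x y, G (x, y + k) = G (x, y))
    (hU : ∀ x, ContDiff ℝ 2 (U x)) (hUper : ∀ x, ∀ k ∈ P, ∀ y, U x (y + k) = U x y)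
    (heq : ∀ x y, ellOp δ S b (fun y => F (x, y)) (U x) y = G (x, y)) (x₀ : X) :
    ∃ M, 0 ≤ M ∧ (∀ᶠ x in 𝓝 x₀, ∀ y, ‖fderiv ℝ (U x) y‖ ≤ M) ∧
      ∀ᶠ p : X × X in 𝓝 (x₀, x₀), ∀ y, |U p.1 y - U p.2 y| ≤ M * ‖p.1 - p.2‖ ∧
        ‖fderiv ℝ (U p.1) y - fderiv ℝ (U p.2) y‖ ≤ M * ‖p.1 - p.2‖ := by
  obtain ⟨B, hB, hFB⟩ := exists_eventually_norm_le hP hF.continuous hFper x₀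
  obtain ⟨BG, hBG, hGB⟩ := exists_eventually_norm_le hP hG.continuous hGper x₀
  obtain ⟨Λ, hΛ, hFΛ⟩ := exists_eventually_norm_sub_le hP hF hFper x₀
  obtain ⟨ΛG, hΛG, hGΛ⟩ := exists_eventually_norm_sub_le hP hG hGper x₀
  obtain ⟨C, hC, hest⟩ := exists_apriori_estimate hP hδ S b hB
  have hfst : Tendsto (fun p : X × X => p.1) (𝓝 (x₀, x₀)) (𝓝 x₀) := continuous_fst.tendsto _
  have hsnd : Tendsto (fun p : X × X => p.2) (𝓝 (x₀, x₀)) (𝓝 x₀) := continuous_snd.tendsto _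
  have hgrad : ∀ᶠ x in 𝓝 x₀, ∀ y, ‖fderiv ℝ (U x) y‖ ≤ C * BG := by
    filter_upwards [hFB, hGB] with x hx hx' y
    exact (hest (U x) _ BG (hU x) (hUper x) hx (fun y => by rw [heq]; exact hx' y) y).2
  refine ⟨C * BG + C * (ΛG + C * BG * Λ), by positivity, ?_, ?_⟩
  · filter_upwards [hgrad] with x hx y
    exact (hx y).trans (le_add_of_nonneg_right (by positivity))
  · filter_upwards [hfst.eventually hFB, hsnd.eventually hgrad, hFΛ, hGΛ] with p h1 h2 h3 h4 y
    have hop : ∀ y, |ellOp δ S b (fun y => F (p.1, y)) (U p.1 - U p.2) y|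
        ≤ (ΛG + C * BG * Λ) * ‖p.1 - p.2‖ := fun y => by
      rw [ellOp_sub (hU _) (hU _), heq, ellOp_change_drift _ (fun y => F (p.2, y)), heq,
        ← sub_sub]
      refine (abs_sub _ _).trans ?_
      have h5 := (fderiv ℝ (U p.2) y).le_of_opNorm_le_of_le (h2 y) (h3 y)
      rw [Real.norm_eq_abs] at h5
      have h6 := h4 y
      rw [Real.norm_eq_abs] at h6
      linarith
    have := hest _ _ _ ((hU p.1).sub (hU p.2))
      (fun k hk y => by simp only [hUper _ k hk]) h1 hop y
    have hd : fderiv ℝ (fun y => U p.1 y - U p.2 y) y = fderiv ℝ (U p.1) y - fderiv ℝ (U p.2) y :=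
      fderiv_fun_sub ((hU p.1).differentiable (by norm_num) y)
        ((hU p.2).differentiable (by norm_num) y)
    rw [hd] at this
    have hle : C * ((ΛG + C * BG * Λ) * ‖p.1 - p.2‖)
        ≤ (C * BG + C * (ΛG + C * BG * Λ)) * ‖p.1 - p.2‖ := by
      nlinarith [mul_nonneg (mul_nonneg hC hBG) (norm_nonneg (p.1 - p.2))]
    exact ⟨this.1.trans hle, this.2.trans hle⟩

theorem eventually_solution_increment_sub_le (hP : ∃ R, ∀ y : E, ∃ k ∈ P, ‖y + k‖ ≤ R)
    (hδ : 0 < δ)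
    (hF : ContDiff ℝ 1 F) (hFper : ∀ k ∈ P, ∀ x y, F (x, y + k) = F (x, y))
    (hG : ContDiff ℝ 1 G) (hGper : ∀ k ∈ P, ∀ x y, G (x, y + k) = G (x, y))
    (hU : ∀ x, ContDiff ℝ 2 (U x)) (hUper : ∀ x, ∀ k ∈ P, ∀ y, U x (y + k) = U x y)
    (heq : ∀ x y, ellOp δ S b (fun y => F (x, y)) (U x) y = G (x, y)) (x₀ : X)
    {ε : ℝ} (hε : 0 < ε) :
    ∀ᶠ p : X × X × X in 𝓝 (x₀, x₀, 0), ∀ y,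
      |U (p.1 + p.2.2) y - U p.1 y - (U (p.2.1 + p.2.2) y - U p.2.1 y)| ≤ ε * ‖p.2.2‖ := by
  obtain ⟨B, hB, hFB⟩ := exists_eventually_norm_le hP hF.continuous hFper x₀
  obtain ⟨Λ, hΛ, hFΛ⟩ := exists_eventually_norm_sub_le hP hF hFper x₀
  obtain ⟨M, hM, hgrad, hlip⟩ :=
    exists_eventually_solution_bounds hP hδ hF hFper hG hGper hU hUper heq x₀
  obtain ⟨C, hC, hest⟩ := exists_apriori_estimate hP hδ S b hB
  set D : ℝ := 1 + M + 2 * M * Λ with hD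
  have hD0 : 0 < D := by positivity
  have hε₁ : 0 < ε / (C * D + 1) := by positivity
  set ε₁ : ℝ := ε / (C * D + 1) with hε₁_def
  have t1 : Tendsto (fun p : X × X × X => p.1) (𝓝 (x₀, x₀, 0)) (𝓝 x₀) :=
    Continuous.tendsto' (by fun_prop) _ _ (by simp)
  have t2 : Tendsto (fun p : X × X × X => p.1 + p.2.2) (𝓝 (x₀, x₀, 0)) (𝓝 x₀) :=
    Continuous.tendsto' (by fun_prop) _ _ (by simp)
  have t3 : Tendsto (fun p : X × X × X => (p.1 + p.2.2, p.2.1 + p.2.2)) (𝓝 (x₀, x₀, 0))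
      (𝓝 (x₀, x₀)) := Continuous.tendsto' (by fun_prop) _ _ (by simp)
  have t4 : Tendsto (fun p : X × X × X => (p.2.1 + p.2.2, p.2.1)) (𝓝 (x₀, x₀, 0))
      (𝓝 (x₀, x₀)) := Continuous.tendsto' (by fun_prop) _ _ (by simp)
  have t5 : Tendsto (fun p : X × X × X => (p.1, p.2.1)) (𝓝 (x₀, x₀, 0))
      (𝓝 (x₀, x₀)) := Continuous.tendsto' (by fun_prop) _ _ (by simp)
  have t6 : Tendsto (fun p : X × X × X => ‖p.1 - p.2.1‖) (𝓝 (x₀, x₀, 0))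
      (𝓝 0) := Continuous.tendsto' (by fun_prop) _ _ (by simp)
  filter_upwards [t1.eventually hFB, t2.eventually hgrad, t3.eventually hlip, t4.eventually hlip,
    t4.eventually hFΛ, t5.eventually hFΛ, t6.eventually (gt_mem_nhds hε₁),
    eventually_norm_increment_sub_le hP hF hFper x₀ hε₁,
    eventually_norm_increment_sub_le hP hG hGper x₀ hε₁]
  rintro ⟨x₁, x₂, e⟩ h1 h2 h3 h4 h5 h6 h7 h8 h9 y
  dsimp only at h1 h2 h3 h4 h5 h6 h7 h8 h9 ⊢
  rw [add_sub_add_right_eq_sub] at h3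
  rw [add_sub_cancel_left] at h4 h5
  have hC2 : ∀ x x', ContDiff ℝ 2 (U x - U x') := fun x x' => (hU x).sub (hU x')
  have hop : ∀ y, |ellOp δ S b (fun y => F (x₁, y)) (U (x₁ + e) - U x₁ - (U (x₂ + e) - U x₂)) y|
      ≤ D * ε₁ * ‖e‖ := fun y => by
    have hid : ellOp δ S b (fun y => F (x₁, y)) (U (x₁ + e) - U x₁ - (U (x₂ + e) - U x₂)) y
        = (G (x₁ + e, y) - G (x₁, y) - (G (x₂ + e, y) - G (x₂, y)))
          - fderiv ℝ (U (x₁ + e)) y (F (x₁ + e, y) - F (x₁, y) - (F (x₂ + e, y) - F (x₂, y)))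
          - (fderiv ℝ (U (x₁ + e)) y - fderiv ℝ (U (x₂ + e)) y) (F (x₂ + e, y) - F (x₂, y))
          - (fderiv ℝ (U (x₂ + e)) y - fderiv ℝ (U x₂) y) (F (x₁, y) - F (x₂, y)) := by
      rw [ellOp_sub (hC2 _ _) (hC2 _ _), ellOp_sub (hU _) (hU _), ellOp_sub (hU _) (hU _),
        heq x₁, ellOp_change_drift _ (fun y => F (x₁ + e, y)) (U (x₁ + e)), heq,
        ellOp_change_drift _ (fun y => F (x₂ + e, y)) (U (x₂ + e)), heq,
        ellOp_change_drift _ (fun y => F (x₂, y)) (U x₂), heq]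
      simp only [map_sub, sub_apply]
      ring
    have b1 := h9 y
    have b2 := (fderiv ℝ (U (x₁ + e)) y).le_of_opNorm_le_of_le (h2 y) (h8 y)
    have b3 := (fderiv ℝ (U (x₁ + e)) y - fderiv ℝ (U (x₂ + e)) y).le_of_opNorm_le_of_le
      (h3 y).2 (h5 y)
    have b4 := (fderiv ℝ (U (x₂ + e)) y - fderiv ℝ (U x₂) y).le_of_opNorm_le_of_le (h4 y).2 (h6 y)
    have b5 : M * Λ * ‖e‖ * ‖x₁ - x₂‖ ≤ M * Λ * ‖e‖ * ε₁ := by gcongr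
    rw [hid, ← Real.norm_eq_abs]
    refine (norm_sub_le_of_le (norm_sub_le_of_le (norm_sub_le_of_le b1 b2) b3) b4).trans ?_
    rw [hD]
    linarith
  have := (hest _ _ _ ((hC2 (x₁ + e) x₁).sub (hC2 (x₂ + e) x₂))
    (fun k hk y => by simp only [Pi.sub_apply, hUper _ k hk]) h1 hop y).1
  refine this.trans ?_
  have hfin : C * D * ε₁ ≤ ε := by
    rw [hε₁_def, mul_div_assoc', div_le_iff₀ (by positivity)]
    nlinarith
  calc C * (D * ε₁ * ‖e‖) = C * D * ε₁ * ‖e‖ := by ring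
    _ ≤ ε * ‖e‖ := by gcongr

/-- Solutions of a periodic elliptic equation depending on a parameter in a `C¹` way are `C¹`. -/
theorem contDiff_one_of_ellOp_eq [FiniteDimensional ℝ X]
    (hP : ∃ R, ∀ y : E, ∃ k ∈ P, ‖y + k‖ ≤ R) (hδ : 0 < δ)
    (hF : ContDiff ℝ 1 F) (hFper : ∀ k ∈ P, ∀ x y, F (x, y + k) = F (x, y))
    (hG : ContDiff ℝ 1 G) (hGper : ∀ k ∈ P, ∀ x y, G (x, y + k) = G (x, y))
    (hU : ∀ x, ContDiff ℝ 2 (U x)) (hUper : ∀ x, ∀ k ∈ P, ∀ y, U x (y + k) = U x y)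
    (heq : ∀ x y, ellOp δ S b (fun y => F (x, y)) (U x) y = G (x, y)) :
    ContDiff ℝ 1 (fun z : X × E => U z.1 z.2) := by
  choose C hC using fun x => exists_bound_of_periodic hP (hU x).continuous (hUper x)
  let V : X → BoundedContinuousFunction E ℝ := fun x =>
    BoundedContinuousFunction.ofNormedAddCommGroup (U x) (hU x).continuous (C x) (hC x)
  have hV : ∀ x y, V x y = U x y := fun x y => rfl
  have hbounds := exists_eventually_solution_bounds hP hδ hF hFper hG hGper hU hUper heq
  have hVc : Continuous V := by
    rw [continuous_iff_continuousAt]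
    intro x₀
    obtain ⟨M, hM, -, hlip⟩ := hbounds x₀
    have t : Tendsto (fun x : X => (x, x₀)) (𝓝 x₀) (𝓝 (x₀, x₀)) :=
      Continuous.tendsto' (by fun_prop) _ _ rfl
    rw [ContinuousAt, tendsto_iff_norm_sub_tendsto_zero]
    have hlim : Tendsto (fun x => M * ‖x - x₀‖) (𝓝 x₀) (𝓝 0) :=
      Continuous.tendsto' (by fun_prop) _ _ (by simp)
    refine squeeze_zero' (Filter.Eventually.of_forall fun _ => norm_nonneg _) ?_ hlim
    filter_upwards [t.eventually hlip] with x hx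
    exact (BoundedContinuousFunction.norm_le (by positivity)).2 fun y => (hx y).1
  have hV1 : ContDiff ℝ 1 V := by
    refine contDiff_one_of_forall_exists_hasStrictFDerivAt fun x₀ =>
      exists_hasStrictFDerivAt_of_increments hVc.continuousAt fun ε hε => ?_
    filter_upwards [eventually_solution_increment_sub_le hP hδ hF hFper hG hGper hU hUper heq x₀
      hε] with p hp
    exact (BoundedContinuousFunction.norm_le (by positivity)).2 hp
  let f₁ : X → E → X →L[ℝ] ℝ := fun x y =>
    (BoundedContinuousFunction.evalCLM ℝ y).comp (fderiv ℝ V x)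
  let f₂ : X → E → E →L[ℝ] ℝ := fun x y => fderiv ℝ (U x) y
  have hf₁ : ∀ x y, HasFDerivAt (fun x => U x y) (f₁ x y) x := fun x y =>
    HasFDerivAt.comp (g := BoundedContinuousFunction.evalCLM ℝ y) (f := V) x
      (ContinuousLinearMap.hasFDerivAt _)
      (hV1.differentiable (by norm_num) x).hasFDerivAt
  have hf₂ : ∀ x y, HasFDerivAt (U x) (f₂ x y) y := fun x y =>
    ((hU x).differentiable (by norm_num) y).hasFDerivAt
  have hc₁ : Continuous (fun z : X × E => f₁ z.1 z.2) := by
    rw [continuous_clm_apply]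
    intro e
    have h1 : Continuous (fun z : X × E => (fderiv ℝ V z.1 e, z.2)) :=
      (((hV1.continuous_fderiv (by norm_num)).clm_apply continuous_const).comp
        continuous_fst).prodMk continuous_snd
    exact continuous_eval.comp h1
  have hc₂ : Continuous (fun z : X × E => f₂ z.1 z.2) := by
    rw [continuous_iff_continuousAt]
    rintro ⟨x₀, y₀⟩
    obtain ⟨M, hM, -, hlip⟩ := hbounds x₀
    have t : Tendsto (fun z : X × E => (z.1, x₀)) (𝓝 (x₀, y₀)) (𝓝 (x₀, x₀)) :=
      Continuous.tendsto' (by fun_prop) _ _ rfl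
    have hcx : Continuous (fderiv ℝ (U x₀)) := (hU x₀).continuous_fderiv (by norm_num)
    rw [ContinuousAt, tendsto_iff_norm_sub_tendsto_zero]
    have hlim : Tendsto (fun z : X × E => M * ‖z.1 - x₀‖
        + ‖fderiv ℝ (U x₀) z.2 - fderiv ℝ (U x₀) y₀‖) (𝓝 (x₀, y₀)) (𝓝 0) :=
      Continuous.tendsto' (by fun_prop) _ _ (by simp)
    refine squeeze_zero' (Filter.Eventually.of_forall fun _ => norm_nonneg _) ?_ hlim
    filter_upwards [t.eventually hlip] with z hz
    refine (norm_sub_le_norm_sub_add_norm_sub _ (fderiv ℝ (U x₀) z.2) _).trans ?_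
    gcongr
    exact (hz z.2).2
  refine contDiff_one_of_forall_exists_hasStrictFDerivAt fun z => ⟨_,
    hasStrictFDerivAt_uncurry_coprod (f := U) (f₁ := f₁) (f₂ := f₂)
      (Filter.Eventually.of_forall fun v => hf₁ v.1 v.2)
      (Filter.Eventually.of_forall fun v => hf₂ v.1 v.2) hc₁.continuousAt hc₂.continuousAt⟩

end Parametric

section Torus

variable {d : ℕ}

theorem Torus.proj_add_of_proj_eq_zero {k : Euc d} (hk : Torus.proj k = 0) (y : Euc d) :
    Torus.proj (y + k) = Torus.proj y := by
  funext i
  have := congrFun hk i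
  simp only [Torus.proj, Pi.zero_apply] at this
  simp [Torus.proj, this]

theorem Torus.exists_proj_eq_zero_norm_add_le :
    ∃ R, ∀ y : Euc d, ∃ k ∈ {k : Euc d | Torus.proj k = 0}, ‖y + k‖ ≤ R := by
  refine ⟨√d, fun y => ⟨WithLp.toLp 2 fun i => ((-⌊y i⌋ : ℤ) : ℝ), ?_, ?_⟩⟩
  · funext i
    exact (AddCircle.coe_eq_zero_iff (1 : ℝ)).2 ⟨-⌊y i⌋, by simp⟩
  · rw [EuclideanSpace.norm_eq]
    refine Real.sqrt_le_sqrt ?_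
    calc _ ≤ ∑ _i : Fin d, (1 : ℝ) := by
          refine Finset.sum_le_sum fun i _ => ?_
          have h0 := Int.fract_nonneg (y i)
          have h1 := (Int.fract_lt_one (y i)).le
          have : (y + WithLp.toLp 2 fun i => ((-⌊y i⌋ : ℤ) : ℝ)) i = Int.fract (y i) := by
            simp [Int.fract, sub_eq_add_neg]
          rw [this, Real.norm_of_nonneg h0]
          exact pow_le_one₀ h0 h1
      _ = d := by simp

theorem Matrix.exists_continuousLinearEquiv_of_isUnit {A : Matrix (Fin d) (Fin d) ℝ}
    (hA : IsUnit A) :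
    ∃ S : Euc d ≃L[ℝ] Euc d, ∀ k, S (EuclideanSpace.single k 1)
      = ∑ i, A i k • EuclideanSpace.single i (1 : ℝ) := by
  let L : Euc d →ₗ[ℝ] Euc d := Matrix.toEuclideanLin A
  obtain ⟨B, hB⟩ := hA.exists_left_inv
  have hL : ∀ v, (L v).ofLp = A.mulVec v.ofLp := fun v => rfl
  have hinj : Function.Injective L := by
    intro v w hvw
    have := congrArg (fun z : Euc d => B.mulVec z.ofLp) hvw
    simp only [hL, Matrix.mulVec_mulVec, hB, Matrix.one_mulVec] at this
    exact PiLp.ext fun i => congrFun this i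
  refine ⟨(LinearEquiv.ofInjectiveEndo L hinj).toContinuousLinearEquiv, fun k => ?_⟩
  change L _ = _
  ext i
  rw [hL]
  simp [Matrix.mulVec_single, Finset.sum_apply, Pi.single_apply]

theorem trAH_mul_transpose (A : Matrix (Fin d) (Fin d) ℝ) (S : Euc d ≃L[ℝ] Euc d)
    (hS : ∀ k, S (EuclideanSpace.single k 1) = ∑ i, A i k • EuclideanSpace.single i (1 : ℝ))
    (w : Euc d → ℝ) (y : Euc d) :
    trAH (A * A.transpose) w y = ∑ k, fderiv ℝ (fderiv ℝ w) y
      (S (EuclideanSpace.basisFun (Fin d) ℝ k)) (S (EuclideanSpace.basisFun (Fin d) ℝ k)) := by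
  simp only [EuclideanSpace.basisFun_apply, hS, map_sum, map_smul, _root_.sum_apply,
    _root_.smul_apply, smul_eq_mul, trAH, hess, iteratedFDeriv_two_apply, Matrix.mul_apply,
    Matrix.transpose_apply, Matrix.cons_val_zero, Matrix.cons_val_one, Finset.sum_mul,
    Finset.mul_sum]
  conv_rhs => rw [Finset.sum_comm]; enter [2, i]; rw [Finset.sum_comm]
  refine Finset.sum_congr rfl fun i _ => Finset.sum_congr rfl fun j _ =>
    Finset.sum_congr rfl fun k _ => ?_
  ring

end Torus

/-- (Lemma B.1.) Let `δ > 0`, `σ₂` an invertible constant matrix and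
`f, g : ℝ^d × 𝕋^d → ℝ^d, ℝ` be C¹. If `u : ℝ^d × 𝕋^d → ℝ` is C² in `y` for each `x` and solves
`δu − tr(σ₂σ₂ᵀ D²_{yy}u) + f(x,y)·D_y u = g(x,y)` classically, then `u` is C¹: the derivatives
`D_x u` and `D_y u` exist and are continuous on `ℝ^d × 𝕋^d`. -/
theorem parametric_elliptic_C1 (d : ℕ)
    (δ : ℝ) (hδ : 0 < δ)
    (σ₂ : Matrix (Fin d) (Fin d) ℝ) (hσ₂ : IsUnit σ₂)
    (f : Euc d → Torus d → Euc d) (g : Euc d → Torus d → ℝ)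
    (hf : ContDiff ℝ 1 (fun z : Euc d × Euc d => f z.1 (Torus.proj z.2)))
    (hg : ContDiff ℝ 1 (fun z : Euc d × Euc d => g z.1 (Torus.proj z.2)))
    (u : Euc d → Torus d → ℝ)
    (hu : ∀ x : Euc d, ContDiff ℝ 2 (fun y : Euc d => u x (Torus.proj y)))
    (heq : ∀ (x y : Euc d),
      δ * u x (Torus.proj y)
        - trAH (σ₂ * σ₂.transpose) (fun y' : Euc d => u x (Torus.proj y')) y
        + ⟪f x (Torus.proj y), gradient (fun y' : Euc d => u x (Torus.proj y')) y⟫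
        = g x (Torus.proj y)) :
    ContDiff ℝ 1 (fun z : Euc d × Euc d => u z.1 (Torus.proj z.2)) := by
  obtain ⟨S, hS⟩ := Matrix.exists_continuousLinearEquiv_of_isUnit hσ₂
  refine contDiff_one_of_ellOp_eq (P := {k : Euc d | Torus.proj k = 0}) (δ := δ) (S := S)
    (b := EuclideanSpace.basisFun (Fin d) ℝ)
    (F := fun z : Euc d × Euc d => f z.1 (Torus.proj z.2))
    (G := fun z : Euc d × Euc d => g z.1 (Torus.proj z.2))
    (U := fun x y => u x (Torus.proj y))
    Torus.exists_proj_eq_zero_norm_add_le hδ hf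
    (fun k hk x y => by simp only [Torus.proj_add_of_proj_eq_zero hk]) hg
    (fun k hk x y => by simp only [Torus.proj_add_of_proj_eq_zero hk]) hu
    (fun x k hk y => by simp only [Torus.proj_add_of_proj_eq_zero hk]) fun x y => ?_
  rw [← heq x y, ellOp, trAH_mul_transpose σ₂ S hS, real_inner_comm, gradient,
    InnerProductSpace.toDual_symm_apply]
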